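/- Assume Hypothesis 1. Then for every t₀ ∈ ℝ an analytic auxiliary family exists: there are a neighbourhood U of (0,0) in ℝ² and functions β̃(t;ε,β₀), B(t;ε,β₀), T-periodic and jointly real-analytic in (t,ε,β₀) on ℝ × U, with β̃ of zero mean in t over [0,T] and β̃ = B = 0 for ε = 0, such that α(t) := α₀(t) + β₀ + β̃(t;ε,β₀), A(t) := A₀ + B(t;ε,β₀) satisfy, for all (ε,β₀) ∈ U and all t ∈ ℝ, α̇(t) = ω(A(t)) + ε F(α(t),A(t),t+t₀) and Ȧ(t) = ε G(α(t),A(t),t+t₀) − (1/T) ∫₀ᵀ ε G(α(τ),A(τ),τ+t₀) dτ. -/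

import Mathlib

open MeasureTheory intervalIntegral Real Filter

noncomputable section

open scoped Topology BoundedContinuousFunction NNReal ENNReal

/-- The Taylor series of `f` at `x` has coefficients bounded by `M ^ (n + 1)` and sums to `f` on
the ball of radius `M⁻¹` around `x`. -/
structure HasTaylorBound {E F : Type*} [NormedAddCommGroup E] [NormedSpace ℝ E]
    [NormedAddCommGroup F] [NormedSpace ℝ F] (f : E → F) (M : ℝ) (x : E) : Prop where
  bound : ∀ n : ℕ, ‖((n.factorial : ℝ)⁻¹) • iteratedFDeriv ℝ n f x‖ ≤ M ^ (n + 1)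
  hasSum : ∀ y : E, M * ‖y‖ < 1 →
    HasSum (fun n : ℕ => ((n.factorial : ℝ)⁻¹) • iteratedFDeriv ℝ n f x (fun _ => y)) (f (x + y))

section Taylor

variable {E F : Type*} [NormedAddCommGroup E] [NormedSpace ℝ E]
  [NormedAddCommGroup F] [NormedSpace ℝ F]

theorem HasTaylorBound.mono {f : E → F} {M M' : ℝ} {x : E} (h : HasTaylorBound f M x)
    (hM : 0 ≤ M) (hMM' : M ≤ M') : HasTaylorBound f M' x where
  bound n := (h.bound n).trans (by gcongr)
  hasSum y hy := h.hasSum y (lt_of_le_of_lt (by gcongr) hy)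

theorem HasTaylorBound.add_period {f : E → F} {M : ℝ} {x v : E} (h : HasTaylorBound f M x)
    (hv : Function.Periodic f v) : HasTaylorBound f M (x + v) := by
  have key : ∀ n, iteratedFDeriv ℝ n f (x + v) = iteratedFDeriv ℝ n f x := fun n => by
    rw [← iteratedFDeriv_comp_add_right, funext hv]
  refine ⟨fun n => by rw [key]; exact h.bound n, fun y hy => ?_⟩
  simp_rw [key, add_right_comm x v y, hv (x + y)]
  exact h.hasSum y hy

theorem norm_inv_factorial_smul_iteratedFDeriv_le [CompleteSpace F] {f : E → F}
    {p : FormalMultilinearSeries ℝ E F} {x : E} {r : ℝ≥0∞} (h : HasFPowerSeriesOnBall f p x r)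
    (n : ℕ) : ‖((n.factorial : ℝ)⁻¹) • iteratedFDeriv ℝ n f x‖ ≤ ‖p n‖ := by
  refine ContinuousMultilinearMap.opNorm_le_bound (norm_nonneg _) fun v => ?_
  rw [_root_.smul_apply, h.iteratedFDeriv_eq_sum_of_completeSpace, norm_smul,
    norm_inv, RCLike.norm_natCast, inv_mul_le_iff₀ (by positivity)]
  refine (norm_sum_le _ _).trans ?_
  have : ∀ σ ∈ (Finset.univ : Finset (Equiv.Perm (Fin n))),
      ‖p n fun i => v (σ i)‖ ≤ ‖p n‖ * ∏ i, ‖v i‖ := fun σ _ => by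
    refine ((p n).le_opNorm _).trans_eq ?_
    rw [Equiv.prod_comp σ fun i => ‖v i‖]
  refine (Finset.sum_le_card_nsmul _ _ _ this).trans_eq ?_
  simp [Finset.card_univ, Fintype.card_perm]

theorem FormalMultilinearSeries.norm_changeOrigin_mul_pow_le
    (p : FormalMultilinearSeries ℝ E F) {r r' : ℝ≥0} (hr : (r + r' : ℝ≥0∞) < p.radius) :
    ∃ C : ℝ, ∀ x : E, ‖x‖ ≤ r → ∀ n, ‖p.changeOrigin x n‖ * (r' : ℝ) ^ n ≤ C := by
  have hs := p.changeOriginSeries_summable_aux₁ hr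
  refine ⟨(∑' s : Σ k l : ℕ, { s : Finset (Fin (k + l)) // s.card = l },
      ‖p (s.1 + s.2.1)‖₊ * r ^ s.2.1 * r' ^ s.1 : ℝ≥0), fun x hx n => ?_⟩
  have hx' : ‖x‖₊ ≤ r := hx
  have hxr : (‖x‖₊ : ℝ≥0∞) < p.radius :=
    lt_of_le_of_lt (le_trans (by exact_mod_cast hx') le_self_add) hr
  suffices ‖p.changeOrigin x n‖₊ * r' ^ n ≤ ∑' s : Σ k l : ℕ, { s : Finset (Fin (k + l)) // s.card = l },
      ‖p (s.1 + s.2.1)‖₊ * r ^ s.2.1 * r' ^ s.1 by exact_mod_cast this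
  have h1 := (NNReal.summable_sigma.1 hs)
  calc ‖p.changeOrigin x n‖₊ * r' ^ n
      ≤ (∑' s : Σ l : ℕ, { s : Finset (Fin (n + l)) // s.card = l },
          ‖p (n + s.1)‖₊ * ‖x‖₊ ^ s.1) * r' ^ n := by
        gcongr
        exact p.nnnorm_changeOrigin_le n hxr
    _ = ∑' s : Σ l : ℕ, { s : Finset (Fin (n + l)) // s.card = l },
          ‖p (n + s.1)‖₊ * ‖x‖₊ ^ s.1 * r' ^ n := by rw [NNReal.tsum_mul_right]
    _ ≤ ∑' s : Σ l : ℕ, { s : Finset (Fin (n + l)) // s.card = l },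
          ‖p (n + s.1)‖₊ * r ^ s.1 * r' ^ n := by
        have hle : ∀ s : Σ l : ℕ, { s : Finset (Fin (n + l)) // s.card = l },
            ‖p (n + s.1)‖₊ * ‖x‖₊ ^ s.1 * r' ^ n ≤ ‖p (n + s.1)‖₊ * r ^ s.1 * r' ^ n :=
          fun s => by gcongr
        exact (NNReal.summable_of_le hle (h1.1 n)).tsum_le_tsum hle (h1.1 n)
    _ ≤ _ := by
        rw [hs.tsum_sigma' h1.1]
        exact h1.2.le_tsum n fun _ _ => zero_le

theorem AnalyticAt.eventually_hasTaylorBound [CompleteSpace F] {f : E → F} {x₀ : E}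
    (hf : AnalyticAt ℝ f x₀) : ∃ M : ℝ, 0 ≤ M ∧ ∀ᶠ x in 𝓝 x₀, HasTaylorBound f M x := by
  obtain ⟨p, R, hp⟩ := hf
  obtain ⟨r, hr0, hrR⟩ : ∃ r : ℝ≥0, 0 < r ∧ (r + r : ℝ≥0∞) < R := by
    obtain ⟨s, hs0, hsR⟩ := ENNReal.lt_iff_exists_nnreal_btwn.1 hp.r_pos
    refine ⟨s / 2, by simpa using hs0, ?_⟩
    rw [← ENNReal.coe_add, add_halves]
    exact hsR
  obtain ⟨C, hC⟩ := p.norm_changeOrigin_mul_pow_le (hrR.trans_le hp.r_le)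
  have hr0' : (0 : ℝ) < r := hr0
  set M : ℝ := max 1 (max C (r : ℝ)⁻¹) with hM
  have hM1 : 1 ≤ M := le_max_left _ _
  have hMC : C ≤ M := (le_max_left _ _).trans (le_max_right _ _)
  have hMr : (r : ℝ)⁻¹ ≤ M := (le_max_right _ _).trans (le_max_right _ _)
  refine ⟨M, by positivity, ?_⟩
  filter_upwards [Metric.ball_mem_nhds x₀ hr0'] with x hx
  have hxn : ‖x - x₀‖ ≤ r := by rw [← dist_eq_norm]; exact hx.le
  have hxe : (‖x - x₀‖₊ : ℝ≥0∞) ≤ r := by exact_mod_cast hxn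
  have hb : HasFPowerSeriesOnBall f (p.changeOrigin (x - x₀)) x (R - ‖x - x₀‖₊) := by
    have := hp.changeOrigin (y := x - x₀) (lt_of_le_of_lt (hxe.trans le_self_add) hrR)
    rwa [add_sub_cancel] at this
  have hrr : (r : ℝ≥0∞) ≤ R - ‖x - x₀‖₊ := by
    refine ENNReal.le_sub_of_add_le_right ENNReal.coe_ne_top ?_
    exact (add_le_add_right hxe _).trans hrR.le
  refine ⟨fun n => ?_, fun y hy => ?_⟩
  · refine (norm_inv_factorial_smul_iteratedFDeriv_le hb n).trans ?_
    have h1 := hC _ hxn n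
    have hrn : (0 : ℝ) < (r : ℝ) ^ n := by positivity
    calc ‖p.changeOrigin (x - x₀) n‖ ≤ C * (r : ℝ)⁻¹ ^ n := by
          rw [inv_pow, ← div_eq_mul_inv, le_div_iff₀ hrn]; exact h1
      _ ≤ M * M ^ n := by gcongr
      _ = M ^ (n + 1) := by ring
  · refine hb.hasSum_iteratedFDeriv ?_
    have h2 : ‖y‖ < r := by
      have : (r : ℝ)⁻¹ * ‖y‖ < 1 := lt_of_le_of_lt (by gcongr) hy
      rwa [inv_mul_lt_iff₀ hr0', mul_one] at this
    refine lt_of_lt_of_le ?_ hrr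
    rw [edist_zero_right, enorm_eq_nnnorm]
    exact_mod_cast h2

theorem IsCompact.exists_hasTaylorBound [CompleteSpace F] {f : E → F} {K : Set E}
    (hK : IsCompact K) (hf : ∀ x ∈ K, AnalyticAt ℝ f x) :
    ∃ M : ℝ, 0 ≤ M ∧ ∀ x ∈ K, HasTaylorBound f M x := by
  refine hK.induction_on (p := fun s => ∃ M : ℝ, 0 ≤ M ∧ ∀ x ∈ s, HasTaylorBound f M x)
    ⟨0, le_rfl, by simp⟩ ?_ ?_ ?_
  · rintro s t hst ⟨M, hM, h⟩
    exact ⟨M, hM, fun x hx => h x (hst hx)⟩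
  · rintro s t ⟨M, hM, h⟩ ⟨M', hM', h'⟩
    refine ⟨max M M', le_max_of_le_left hM, fun x hx => ?_⟩
    rcases hx with hx | hx
    · exact (h x hx).mono hM (le_max_left _ _)
    · exact (h' x hx).mono hM' (le_max_right _ _)
  · intro x hx
    obtain ⟨M, hM, h⟩ := (hf x hx).eventually_hasTaylorBound
    exact ⟨_, mem_nhdsWithin_of_mem_nhds h, M, hM, fun y hy => hy⟩

end Taylor

section Superposition

variable {K E F : Type*} [TopologicalSpace K] [NormedAddCommGroup E] [NormedSpace ℝ E]
  [NormedAddCommGroup F] [NormedSpace ℝ F]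

/-- A bounded continuous family of multilinear maps acts pointwise on bounded continuous
functions. -/
def pointwiseMultilinear {n : ℕ} (q : K → E [×n]→L[ℝ] F) (hq : Continuous q) (C : ℝ)
    (hC : ∀ k, ‖q k‖ ≤ C) : (K →ᵇ E) [×n]→L[ℝ] (K →ᵇ F) :=
  MultilinearMap.mkContinuous
    { toFun := fun h => BoundedContinuousFunction.ofNormedAddCommGroup
        (fun k => q k fun i => h i k) (by fun_prop) (C * ∏ i, ‖h i‖) fun k =>
          ((q k).le_opNorm _).trans <| by
            have hC0 : 0 ≤ C := (norm_nonneg _).trans (hC k)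
            gcongr with i
            · exact hC k
            · exact (h i).norm_coe_le_norm k
      map_update_add' := fun h i a b => by
        ext k
        have key : ∀ c : K →ᵇ E, (fun j => Function.update h i c j k)
            = Function.update (fun j => h j k) i (c k) := fun c => by
          ext j
          rcases eq_or_ne j i with rfl | hj <;> simp [*]
        simp [key]
      map_update_smul' := fun h i c a => by
        ext k
        have key : ∀ c : K →ᵇ E, (fun j => Function.update h i c j k)
            = Function.update (fun j => h j k) i (c k) := fun c => by
          ext j
          rcases eq_or_ne j i with rfl | hj <;> simp [*]
        simp [key] }
    (max C 0) fun h => by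
      refine (BoundedContinuousFunction.norm_le (by positivity)).2 fun k => ?_
      refine ((q k).le_opNorm _).trans ?_
      gcongr with i
      · exact (hC k).trans (le_max_left _ _)
      · exact (h i).norm_coe_le_norm k

@[simp]
theorem pointwiseMultilinear_apply {n : ℕ} (q : K → E [×n]→L[ℝ] F) (hq : Continuous q) (C : ℝ)
    (hC : ∀ k, ‖q k‖ ≤ C) (h : Fin n → K →ᵇ E) (k : K) :
    pointwiseMultilinear q hq C hC h k = q k fun i => h i k := rfl

theorem norm_pointwiseMultilinear_le {n : ℕ} (q : K → E [×n]→L[ℝ] F) (hq : Continuous q) (C : ℝ)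
    (hC : ∀ k, ‖q k‖ ≤ C) : ‖pointwiseMultilinear q hq C hC‖ ≤ max C 0 :=
  MultilinearMap.mkContinuous_norm_le _ (le_max_right _ _) _

/-- The superposition operator of a function with uniformly bounded Taylor series along a
continuous family of base points is analytic on bounded continuous functions. -/
theorem exists_analyticAt_superposition [CompleteSpace F] {f : E → F} {x : K → E} {M : ℝ}
    (hM : 0 ≤ M) (hx : ∀ k, HasTaylorBound f M (x k))
    (hc : ∀ n, Continuous fun k => iteratedFDeriv ℝ n f (x k)) :
    ∃ N : (K →ᵇ E) → (K →ᵇ F), AnalyticAt ℝ N 0 ∧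
      ∃ r > 0, ∀ h : K →ᵇ E, ‖h‖ < r → ∀ k, N h k = f (x k + h k) := by
  have hx' : ∀ k, HasTaylorBound f (M + 1) (x k) := fun k => (hx k).mono hM (by linarith)
  have hM1 : 0 < M + 1 := by linarith
  let P : FormalMultilinearSeries ℝ (K →ᵇ E) (K →ᵇ F) := fun n =>
    pointwiseMultilinear (fun k => ((n.factorial : ℝ)⁻¹) • iteratedFDeriv ℝ n f (x k))
      (by have := hc n; fun_prop) ((M + 1) ^ (n + 1)) fun k => (hx' k).bound n
  let ρ : ℝ≥0 := ⟨(M + 1)⁻¹, by positivity⟩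
  have hρ : 0 < ρ := by
    change (0 : ℝ) < (M + 1)⁻¹
    positivity
  have hrad : (ρ : ℝ≥0∞) ≤ P.radius := by
    refine P.le_radius_of_bound (M + 1) fun n => ?_
    have h1 : ‖P n‖ ≤ (M + 1) ^ (n + 1) :=
      (norm_pointwiseMultilinear_le _ _ _ _).trans_eq (max_eq_left (by positivity))
    calc ‖P n‖ * (ρ : ℝ) ^ n ≤ (M + 1) ^ (n + 1) * ((M + 1)⁻¹) ^ n := by
          change ‖P n‖ * ((M + 1)⁻¹) ^ n ≤ _
          gcongr
      _ = M + 1 := by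
          rw [pow_succ', mul_assoc, ← mul_pow, mul_inv_cancel₀ hM1.ne', one_pow, mul_one]
  have hP := P.hasFPowerSeriesOnBall (lt_of_lt_of_le (by exact_mod_cast hρ) hrad)
  refine ⟨P.sum, hP.analyticAt, ρ, hρ, fun h hh k => ?_⟩
  have hmem : h ∈ Metric.eball (0 : K →ᵇ E) P.radius := by
    refine lt_of_lt_of_le ?_ hrad
    rw [edist_zero_right, enorm_eq_nnnorm]
    exact_mod_cast hh
  have hs := (hP.hasSum hmem).mapL (BoundedContinuousFunction.evalCLM ℝ k)
  rw [zero_add] at hs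
  refine hs.unique ?_
  refine (hx' k).hasSum (h k) ?_
  have hhk : ‖h k‖ < (M + 1)⁻¹ := (h.norm_coe_le_norm k).trans_lt hh
  rwa [← one_div, lt_div_iff₀' hM1] at hhk

end Superposition

section FlowIntegral

variable {V : Type*} [NormedAddCommGroup V] [NormedSpace ℝ V]

/-- The operator that sends `g` to its `κ`-weighted integral along the orbit segment
`{k + s • v | 0 ≤ s ≤ T}`, as a function of the initial point `k`. -/
def flowIntegral (κ : ℝ → ℝ) (hκ : Continuous κ) (T : ℝ) (v : V) : (V →ᵇ ℝ) →L[ℝ] (V →ᵇ ℝ) :=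
  have hbound : ∃ C, ∀ s ∈ Set.uIcc 0 T, ‖κ s‖ ≤ C :=
    isCompact_uIcc.exists_bound_of_continuousOn hκ.continuousOn
  have hle : ∀ (g : V →ᵇ ℝ) (k : V),
      ‖∫ s in (0 : ℝ)..T, κ s * g (k + s • v)‖ ≤ hbound.choose * |T| * ‖g‖ := fun g k => by
    have h1 : ∀ s ∈ Set.uIoc 0 T, ‖κ s * g (k + s • v)‖ ≤ hbound.choose * ‖g‖ := fun s hs => by
      rw [norm_mul]
      have h2 := hbound.choose_spec s (Set.uIoc_subset_uIcc hs)
      exact mul_le_mul h2 (g.norm_coe_le_norm _) (norm_nonneg _) ((norm_nonneg _).trans h2)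
    refine (norm_integral_le_of_norm_le_const h1).trans_eq ?_
    rw [sub_zero]
    ring
  LinearMap.mkContinuous
    { toFun := fun g => BoundedContinuousFunction.ofNormedAddCommGroup
        (fun k => ∫ s in (0 : ℝ)..T, κ s * g (k + s • v))
        (continuous_parametric_intervalIntegral_of_continuous' (by fun_prop) _ _) _ (hle g)
      map_add' := fun g₁ g₂ => by
        ext k
        simp only [BoundedContinuousFunction.coe_ofNormedAddCommGroup,
          BoundedContinuousFunction.add_apply, mul_add]
        refine integral_add ?_ ?_ <;> exact Continuous.intervalIntegrable (by fun_prop) _ _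
      map_smul' := fun c g => by
        ext k
        simp only [BoundedContinuousFunction.coe_ofNormedAddCommGroup,
          BoundedContinuousFunction.smul_apply, smul_eq_mul, RingHom.id_apply,
          mul_left_comm _ c, intervalIntegral.integral_const_mul] }
    (max (hbound.choose * |T|) 0) fun g => by
      refine (BoundedContinuousFunction.norm_le (by positivity)).2 fun k => ?_
      refine (hle g k).trans ?_
      gcongr
      exact le_max_left _ _

@[simp]
theorem flowIntegral_apply (κ : ℝ → ℝ) (hκ : Continuous κ) (T : ℝ) (v : V) (g : V →ᵇ ℝ) (k : V) :
    flowIntegral κ hκ T v g k = ∫ s in (0 : ℝ)..T, κ s * g (k + s • v) := rfl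

end FlowIntegral

section PeriodicPrimitive

variable {T : ℝ} {g : ℝ → ℝ}

theorem integral_comp_add_left_of_periodic (hper : Function.Periodic g T) (t : ℝ) :
    ∫ s in (0 : ℝ)..T, g (t + s) = ∫ s in (0 : ℝ)..T, g s := by
  rw [intervalIntegral.integral_comp_add_left]
  simpa using hper.intervalIntegral_add_eq t 0

/-- Convolution with the sawtooth kernel inverts `d/dt` modulo the mean on periodic functions. -/
theorem hasDerivAt_sawtooth_integral (hT : T ≠ 0) (hg : Continuous g)
    (hper : Function.Periodic g T) (t : ℝ) :
    HasDerivAt (fun t => ∫ s in (0 : ℝ)..T, (s / T - 1 / 2) * g (t + s))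
      (g t - (1 / T) * ∫ s in (0 : ℝ)..T, g s) t := by
  set Γ : ℝ → ℝ := fun u => ∫ s in (0 : ℝ)..u, g s with hΓ
  have hΓd : ∀ u, HasDerivAt Γ (g u) u := fun u => hg.integral_hasStrictDerivAt 0 u |>.hasDerivAt
  have hΓc : Continuous Γ := continuous_iff_continuousAt.2 fun u => (hΓd u).continuousAt
  have key : (fun t => ∫ s in (0 : ℝ)..T, (s / T - 1 / 2) * g (t + s)) = fun t =>
      (Γ (t + T) + Γ t) / 2 - (1 / T) * ((∫ s in (0 : ℝ)..(t + T), Γ s) - ∫ s in (0 : ℝ)..t, Γ s) := by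
    ext t
    have hu : ∀ s ∈ Set.uIcc 0 T, HasDerivAt (fun s => s / T - 1 / 2) (1 / T) s := fun s _ =>
      ((hasDerivAt_id s).div_const T).sub_const _
    have hv : ∀ s ∈ Set.uIcc 0 T, HasDerivAt (fun s => Γ (t + s)) (g (t + s)) s := fun s _ =>
      (hΓd (t + s)).comp_const_add t s
    rw [integral_mul_deriv_eq_deriv_mul hu hv intervalIntegrable_const
      (Continuous.intervalIntegrable (by fun_prop) _ _), intervalIntegral.integral_const_mul,
      intervalIntegral.integral_comp_add_left, add_zero,
      integral_interval_sub_left (hΓc.intervalIntegrable _ _) (hΓc.intervalIntegrable _ _),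
      div_self hT, zero_div]
    ring
  rw [key]
  have hint : ∀ u, HasDerivAt (fun u => ∫ s in (0 : ℝ)..u, Γ s) (Γ u) u := fun u =>
    hΓc.integral_hasStrictDerivAt 0 u |>.hasDerivAt
  have hmain := ((((hΓd (t + T)).comp_add_const t T).add (hΓd t)).div_const 2).sub
    ((((hint (t + T)).comp_add_const t T).sub (hint t)).const_mul (1 / T))
  refine hmain.congr_deriv ?_
  have h1 : Γ (t + T) - Γ t = ∫ s in (0 : ℝ)..T, g s := by
    rw [hΓ, integral_interval_sub_left (hg.intervalIntegrable _ _) (hg.intervalIntegrable _ _)]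
    simpa using hper.intervalIntegral_add_eq t 0
  rw [h1, hper t]
  ring

theorem integral_sawtooth_integral_eq_zero (hg : Continuous g) (hper : Function.Periodic g T) :
    ∫ t in (0 : ℝ)..T, ∫ s in (0 : ℝ)..T, (s / T - 1 / 2) * g (t + s) = 0 := by
  have hint : IntegrableOn (Function.uncurry fun t s => (s / T - 1 / 2) * g (t + s))
      (Set.uIcc 0 T ×ˢ Set.uIcc 0 T) :=
    ContinuousOn.integrableOn_compact (isCompact_uIcc.prod isCompact_uIcc)
      (Continuous.continuousOn (by fun_prop))
  rw [intervalIntegral_intervalIntegral_swap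
    (hint.mono_set (Set.prod_mono Set.uIoc_subset_uIcc Set.uIoc_subset_uIcc))]
  simp_rw [intervalIntegral.integral_const_mul, add_comm _ (_ : ℝ),
    integral_comp_add_left_of_periodic hper, intervalIntegral.integral_mul_const]
  rw [intervalIntegral.integral_sub (Continuous.intervalIntegrable (by fun_prop) _ _)
    intervalIntegrable_const, intervalIntegral.integral_div, integral_id,
    intervalIntegral.integral_const]
  rcases eq_or_ne T 0 with rfl | hT
  · simp
  · simp only [smul_eq_mul]
    field_simp
    ring

end PeriodicPrimitive

section ImplicitSolution

variable {K : Type*} [TopologicalSpace K]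

/-- The constant functions, as a continuous linear map into the bounded continuous functions. -/
def constBoundedCLM (K E : Type*) [TopologicalSpace K] [NormedAddCommGroup E] [NormedSpace ℝ E] :
    E →L[ℝ] (K →ᵇ E) :=
  LinearMap.mkContinuous
    { toFun := BoundedContinuousFunction.const K
      map_add' := fun _ _ => rfl
      map_smul' := fun _ _ => rfl } 1 fun x => by
        rw [one_mul]
        exact BoundedContinuousFunction.norm_const_le x

@[simp]
theorem constBoundedCLM_apply {E : Type*} [NormedAddCommGroup E] [NormedSpace ℝ E] (x : E) (k : K) :
    constBoundedCLM K E x k = x := rfl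

/-- Embedding of scalar functions as the angle component. -/
def angleEmb (K : Type*) [TopologicalSpace K] : (K →ᵇ ℝ) →L[ℝ] (K →ᵇ ℝ × ℝ × ℝ) :=
  (ContinuousLinearMap.inl ℝ ℝ (ℝ × ℝ)).compLeftContinuousBounded K

/-- Embedding of scalar functions as the action component. -/
def actionEmb (K : Type*) [TopologicalSpace K] : (K →ᵇ ℝ) →L[ℝ] (K →ᵇ ℝ × ℝ × ℝ) :=
  ((ContinuousLinearMap.inr ℝ ℝ (ℝ × ℝ)).comp
    (ContinuousLinearMap.inl ℝ ℝ ℝ)).compLeftContinuousBounded K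

/-- Projection to the action component. -/
def actionProj (K : Type*) [TopologicalSpace K] : (K →ᵇ ℝ × ℝ × ℝ) →L[ℝ] (K →ᵇ ℝ) :=
  ((ContinuousLinearMap.fst ℝ ℝ ℝ).comp
    (ContinuousLinearMap.snd ℝ ℝ (ℝ × ℝ))).compLeftContinuousBounded K

@[simp]
theorem angleEmb_apply (g : K →ᵇ ℝ) (k : K) : angleEmb K g k = (g k, 0, 0) := rfl

@[simp]
theorem actionEmb_apply (g : K →ᵇ ℝ) (k : K) : actionEmb K g k = (0, g k, 0) := rfl

@[simp]
theorem actionProj_apply (y : K →ᵇ ℝ × ℝ × ℝ) (k : K) : actionProj K y k = (y k).2.1 := rfl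

/-- The residual whose zeros are the solutions of the auxiliary system with parameters
`(ε, c) = x.1`, where `P` is a primitive operator, `M` a mean and `w` the twist. -/
def auxResidual (P M : (K →ᵇ ℝ) →L[ℝ] (K →ᵇ ℝ)) (w : ℝ)
    (Nω NF NG : (K →ᵇ ℝ × ℝ × ℝ) → (K →ᵇ ℝ))
    (x : (ℝ × ℝ × ℝ × ℝ) × (K →ᵇ ℝ × ℝ × ℝ)) : K →ᵇ ℝ × ℝ × ℝ :=
  x.2 - constBoundedCLM K _ x.1.2 - angleEmb K (P (Nω x.2 + x.1.1 • NF x.2))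
    - actionEmb K (M (actionProj K x.2) + x.1.1 • P (NG x.2)
      - w⁻¹ • M (Nω x.2 + x.1.1 • NF x.2))

variable {P M : (K →ᵇ ℝ) →L[ℝ] (K →ᵇ ℝ)} {w : ℝ} {Nω NF NG : (K →ᵇ ℝ × ℝ × ℝ) → (K →ᵇ ℝ)}

theorem analyticAt_auxResidual (hω : AnalyticAt ℝ Nω 0) (hF : AnalyticAt ℝ NF 0)
    (hG : AnalyticAt ℝ NG 0) : AnalyticAt ℝ (auxResidual P M w Nω NF NG) 0 := by
  have h2 : AnalyticAt ℝ
      (fun x : (ℝ × ℝ × ℝ × ℝ) × (K →ᵇ ℝ × ℝ × ℝ) => x.2) 0 := analyticAt_snd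
  have hε : AnalyticAt ℝ
      (fun x : (ℝ × ℝ × ℝ × ℝ) × (K →ᵇ ℝ × ℝ × ℝ) => x.1.1) 0 :=
    ((ContinuousLinearMap.fst ℝ ℝ (ℝ × ℝ × ℝ)).comp
      (ContinuousLinearMap.fst ℝ _ (K →ᵇ ℝ × ℝ × ℝ))).analyticAt _
  have hc : AnalyticAt ℝ
      (fun x : (ℝ × ℝ × ℝ × ℝ) × (K →ᵇ ℝ × ℝ × ℝ) => constBoundedCLM K _ x.1.2) 0 :=
    ((constBoundedCLM K (ℝ × ℝ × ℝ)).comp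
      ((ContinuousLinearMap.snd ℝ ℝ (ℝ × ℝ × ℝ)).comp
        (ContinuousLinearMap.fst ℝ _ (K →ᵇ ℝ × ℝ × ℝ)))).analyticAt _
  have hω' : AnalyticAt ℝ
      (fun x : (ℝ × ℝ × ℝ × ℝ) × (K →ᵇ ℝ × ℝ × ℝ) => Nω x.2) 0 := hω.comp_of_eq h2 rfl
  have hF' : AnalyticAt ℝ
      (fun x : (ℝ × ℝ × ℝ × ℝ) × (K →ᵇ ℝ × ℝ × ℝ) => NF x.2) 0 := hF.comp_of_eq h2 rfl
  have hG' : AnalyticAt ℝ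
      (fun x : (ℝ × ℝ × ℝ × ℝ) × (K →ᵇ ℝ × ℝ × ℝ) => NG x.2) 0 := hG.comp_of_eq h2 rfl
  have hh := hω'.add (hε.smul hF')
  have hlin : ∀ {A B : Type _} [NormedAddCommGroup A] [NormedSpace ℝ A] [NormedAddCommGroup B]
      [NormedSpace ℝ B] (L : A →L[ℝ] B) {f : (ℝ × ℝ × ℝ × ℝ) × (K →ᵇ ℝ × ℝ × ℝ) → A},
      AnalyticAt ℝ f 0 → AnalyticAt ℝ (fun x => L (f x)) 0 := fun L f hf =>
    (L.analyticAt _).comp hf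
  exact ((h2.sub hc).sub (hlin _ (hlin P hh))).sub
    (hlin _ (((hlin M (hlin _ h2)).add (hε.smul (hlin P hG'))).sub
      (hlin (w⁻¹ • M) hh)))

theorem isInvertible_fderiv_auxResidual (hω : AnalyticAt ℝ Nω 0) (hF : AnalyticAt ℝ NF 0)
    (hG : AnalyticAt ℝ NG 0) (hω' : HasFDerivAt Nω (w • actionProj K) 0) (hw : w ≠ 0) :
    (fderiv ℝ (auxResidual P M w Nω NF NG) 0 ∘L .inr ℝ _ _).IsInvertible := by
  set R := angleEmb K ∘L P ∘L actionProj K with hR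
  have hRR : ∀ y, R (R y) = 0 := fun y => by
    have : actionProj K (R y) = 0 := by ext k; simp [hR]
    change angleEmb K (P (actionProj K (R y))) = 0
    rw [this, map_zero, map_zero]
  have hD : HasFDerivAt (fun y => auxResidual P M w Nω NF NG (0, y))
      (ContinuousLinearMap.id ℝ _ - w • R) 0 := by
    have h1 : HasFDerivAt (fun y => y - angleEmb K (P (Nω y))
        - actionEmb K (M (actionProj K y) - w⁻¹ • M (Nω y))) _ 0 :=
      ((hasFDerivAt_id (𝕜 := ℝ) (0 : K →ᵇ ℝ × ℝ × ℝ)).sub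
        (((angleEmb K ∘L P).hasFDerivAt).comp 0 hω')).sub
        ((actionEmb K).hasFDerivAt.comp 0
          (((M ∘L actionProj K).hasFDerivAt).sub
            ((M.hasFDerivAt.comp 0 hω').const_smul w⁻¹)))
    convert! h1 using 1
    · ext1 y
      simp [auxResidual]
    · ext1 y
      simp [hR, smul_smul, hw]
  have hE : fderiv ℝ (auxResidual P M w Nω NF NG) 0 ∘L .inr ℝ _ _
      = ContinuousLinearMap.id ℝ _ - w • R := by
    refine HasFDerivAt.unique ?_ hD
    exact HasFDerivAt.comp (g := auxResidual P M w Nω NF NG) (f := fun y => (0, y)) 0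
      (analyticAt_auxResidual hω hF hG).differentiableAt.hasFDerivAt
      (hasFDerivAt_prodMk_right _ _)
  rw [hE]
  refine ContinuousLinearMap.IsInvertible.of_inverse
    (g := ContinuousLinearMap.id ℝ _ + w • R) ?_ ?_ <;>
  · refine ContinuousLinearMap.ext fun y => BoundedContinuousFunction.ext fun k => ?_
    simp [hRR]

/-- Analytic solvability of the auxiliary equation near the origin. -/
theorem exists_analyticAt_auxResidual_eq_zero_iff (hω : AnalyticAt ℝ Nω 0)
    (hF : AnalyticAt ℝ NF 0) (hG : AnalyticAt ℝ NG 0) (hω0 : Nω 0 = 0)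
    (hω' : HasFDerivAt Nω (w • actionProj K) 0) (hw : w ≠ 0) :
    ∃ ψ : ℝ × ℝ × ℝ × ℝ → (K →ᵇ ℝ × ℝ × ℝ), AnalyticAt ℝ ψ 0 ∧ ψ 0 = 0 ∧
      ∀ᶠ x in 𝓝 (0 : (ℝ × ℝ × ℝ × ℝ) × (K →ᵇ ℝ × ℝ × ℝ)),
        auxResidual P M w Nω NF NG x = 0 ↔ ψ x.1 = x.2 := by
  have hcd := (analyticAt_auxResidual (P := P) (M := M) (w := w) hω hF hG).contDiffAt (n := ⊤)
  have hinv := isInvertible_fderiv_auxResidual (P := P) (M := M) hω hF hG hω' hw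
  have h0 : auxResidual P M w Nω NF NG 0 = 0 := by simp [auxResidual, hω0]
  refine ⟨hcd.implicitFunction (by simp) hinv,
    (hcd.contDiffAt_implicitFunction (by simp) hinv).analyticAt,
    hcd.implicitFunction_apply_self (by simp) hinv, ?_⟩
  have h := hcd.eventually_apply_eq_iff_implicitFunction (by simp) hinv
  rwa [h0] at h

end ImplicitSolution

section SolutionField

/-- The superposition operator around the section `{A = A₀}` of a function that is analytic there
and `2π`-periodic in the first and third variables. -/
theorem exists_analyticAt_superposition_of_periodic {f : ℝ × ℝ × ℝ → ℝ} {A₀ : ℝ}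
    (hf : ∀ φ θ, AnalyticAt ℝ f (φ, A₀, θ)) (hφ : Function.Periodic f (2 * π, 0, 0))
    (hθ : Function.Periodic f (0, 0, 2 * π)) :
    ∃ N : (ℝ × ℝ →ᵇ ℝ × ℝ × ℝ) → (ℝ × ℝ →ᵇ ℝ), AnalyticAt ℝ N 0 ∧
      ∃ r > 0, ∀ y, ‖y‖ < r → ∀ k : ℝ × ℝ, N y k = f ((k.1, A₀, k.2) + y k) := by
  have hK : IsCompact ((fun k : ℝ × ℝ => (k.1, A₀, k.2)) ''
      (Set.Icc 0 (2 * π) ×ˢ Set.Icc 0 (2 * π))) :=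
    (isCompact_Icc.prod isCompact_Icc).image (by fun_prop)
  obtain ⟨M, hM, hb⟩ := hK.exists_hasTaylorBound (f := f) (by
    rintro _ ⟨k, -, rfl⟩
    exact hf _ _)
  refine exists_analyticAt_superposition (x := fun k : ℝ × ℝ => (k.1, A₀, k.2)) hM
    (fun k => ?_) fun n => ?_
  · set a := toIcoMod two_pi_pos 0 k.1 with ha
    set b := toIcoMod two_pi_pos 0 k.2 with hb'
    have h1 : HasTaylorBound f M (a, A₀, b) := by
      refine hb _ ⟨(a, b), ⟨?_, ?_⟩, rfl⟩
      · simpa using Set.Ico_subset_Icc_self (toIcoMod_mem_Ico two_pi_pos 0 k.1)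
      · simpa using Set.Ico_subset_Icc_self (toIcoMod_mem_Ico two_pi_pos 0 k.2)
    have h2 := (h1.add_period (hφ.zsmul (toIcoDiv two_pi_pos 0 k.1))).add_period
      (hθ.zsmul (toIcoDiv two_pi_pos 0 k.2))
    convert h2 using 1
    ext
    · simp [ha]
    · simp
    · simp [hb']
  · refine continuous_iff_continuousAt.2 fun k => ?_
    have h1 : ContinuousAt (iteratedFDeriv ℝ n f) (k.1, A₀, k.2) :=
      ((hf k.1 k.2).contDiffAt (n := ⊤).iteratedFDeriv_right (m := 0) (i := n) le_top).continuousAt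
    exact ContinuousAt.comp (f := fun k : ℝ × ℝ => (k.1, A₀, k.2)) h1 (by fun_prop)

/-- The derivative at the origin of a superposition operator whose integrand has derivative
`w • dA` along the section. -/
theorem hasFDerivAt_superposition {K E : Type*} [TopologicalSpace K] [NormedAddCommGroup E]
    [NormedSpace ℝ E] {f : E → ℝ} {x : K → E} {N : (K →ᵇ E) → (K →ᵇ ℝ)} (hN : AnalyticAt ℝ N 0)
    {r : ℝ} (hr : 0 < r) (hNf : ∀ y, ‖y‖ < r → ∀ k, N y k = f (x k + y k))
    {L : E →L[ℝ] ℝ} (hL : ∀ k, HasFDerivAt f L (x k)) :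
    HasFDerivAt N (L.compLeftContinuousBounded K) 0 := by
  have hD := hN.differentiableAt.hasFDerivAt
  suffices h : fderiv ℝ N 0 = L.compLeftContinuousBounded K by rwa [h] at hD
  ext y k
  have hline : HasDerivAt (fun s : ℝ => s • y) y 0 := by
    simpa using (hasDerivAt_id (0 : ℝ)).smul_const y
  have h1 : HasDerivAt (fun s : ℝ => N (s • y) k) (fderiv ℝ N 0 y k) 0 := by
    have := HasFDerivAt.comp_hasDerivAt_of_eq (0 : ℝ) hD hline (by simp)
    exact (BoundedContinuousFunction.evalCLM ℝ k).hasFDerivAt.comp_hasDerivAt (0 : ℝ) this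
  have h2 : HasDerivAt (fun s : ℝ => f (x k + s • y k)) (L (y k)) 0 := by
    have hl : HasDerivAt (fun s : ℝ => x k + s • y k) (y k) 0 := by
      simpa using ((hasDerivAt_id (0 : ℝ)).smul_const (y k)).const_add (x k)
    exact HasFDerivAt.comp_hasDerivAt_of_eq (0 : ℝ) (hL k) hl (by simp)
  refine h1.unique (h2.congr_of_eventuallyEq ?_)
  have hsmall : ∀ᶠ s : ℝ in 𝓝 0, ‖s • y‖ < r := by
    have : Tendsto (fun s : ℝ => ‖s • y‖) (𝓝 0) (𝓝 0) := by
      have hc : Continuous fun s : ℝ => ‖s • y‖ := by fun_prop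
      simpa using hc.tendsto 0
    exact this.eventually_lt_const hr
  filter_upwards [hsmall] with s hs
  simp [hNf _ hs]

theorem flowIntegral_apply_of_shift {V : Type*} [NormedAddCommGroup V] [NormedSpace ℝ V]
    {κ : ℝ → ℝ} {hκ : Continuous κ} {T : ℝ} {v s : V} {g g' : V →ᵇ ℝ}
    (h : ∀ k, g' k = g (k + s)) (k : V) :
    flowIntegral κ hκ T v g' k = flowIntegral κ hκ T v g (k + s) := by
  simp [h, add_right_comm]

theorem auxResidual_eq_zero_iff {K : Type*} [TopologicalSpace K]
    {P M : (K →ᵇ ℝ) →L[ℝ] (K →ᵇ ℝ)} {w : ℝ} {Nω NF NG : (K →ᵇ ℝ × ℝ × ℝ) → (K →ᵇ ℝ)}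
    {ε : ℝ} {c : ℝ × ℝ × ℝ} {y : K →ᵇ ℝ × ℝ × ℝ} :
    auxResidual P M w Nω NF NG ((ε, c), y) = 0 ↔ ∀ k, y k = c + (P (Nω y + ε • NF y) k,
      M (actionProj K y) k + ε * P (NG y) k - w⁻¹ * M (Nω y + ε • NF y) k, 0) := by
  rw [BoundedContinuousFunction.ext_iff]
  refine forall_congr' fun k => ?_
  simp only [auxResidual, BoundedContinuousFunction.sub_apply, BoundedContinuousFunction.coe_zero,
    Pi.zero_apply, constBoundedCLM_apply, angleEmb_apply, actionEmb_apply,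
    BoundedContinuousFunction.add_apply, BoundedContinuousFunction.smul_apply, smul_eq_mul]
  rw [sub_sub, sub_sub, sub_eq_zero]
  simp

/-- Zeros of the auxiliary residual are carried to zeros by simultaneous shifts of the torus and
of the phases. -/
theorem auxResidual_eq_zero_of_shift {V : Type*} [NormedAddCommGroup V] [NormedSpace ℝ V]
    {κ₁ κ₂ : ℝ → ℝ} {hκ₁ : Continuous κ₁} {hκ₂ : Continuous κ₂} {T : ℝ} {v s : V} {w : ℝ}
    {Nω NF NG : (V →ᵇ ℝ × ℝ × ℝ) → (V →ᵇ ℝ)} {ε : ℝ} {c : ℝ × ℝ × ℝ} (hc : c.2.1 = 0)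
    {y y' : V →ᵇ ℝ × ℝ × ℝ} (hy' : ∀ k, y' k = c + y (k + s))
    (hω : ∀ k, Nω y' k = Nω y (k + s)) (hF : ∀ k, NF y' k = NF y (k + s))
    (hG : ∀ k, NG y' k = NG y (k + s))
    (hy : auxResidual (flowIntegral κ₁ hκ₁ T v) (flowIntegral κ₂ hκ₂ T v) w Nω NF NG
      ((ε, 0), y) = 0) :
    auxResidual (flowIntegral κ₁ hκ₁ T v) (flowIntegral κ₂ hκ₂ T v) w Nω NF NG
      ((ε, c), y') = 0 := by
  rw [auxResidual_eq_zero_iff] at hy ⊢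
  intro k
  have hh : ∀ k, (Nω y' + ε • NF y') k = (Nω y + ε • NF y) (k + s) := fun k => by
    simp [hω, hF]
  have hA : ∀ k, actionProj V y' k = actionProj V y (k + s) := fun k => by
    simp [hy', hc]
  rw [flowIntegral_apply_of_shift hh, flowIntegral_apply_of_shift hh,
    flowIntegral_apply_of_shift hG, flowIntegral_apply_of_shift hA, hy', hy (k + s), zero_add]

/-- Existence of the solution of the auxiliary system as an analytic field on the torus. The
triple `(β, B, 0) = u ε k` is the deviation from the section at the phases `k`. -/
theorem exists_analytic_solution_field {fω fF fG : ℝ × ℝ × ℝ → ℝ} {A₀ : ℝ}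
    (hω : ∀ φ θ, AnalyticAt ℝ fω (φ, A₀, θ)) (hF : ∀ φ θ, AnalyticAt ℝ fF (φ, A₀, θ))
    (hG : ∀ φ θ, AnalyticAt ℝ fG (φ, A₀, θ))
    (hωφ : Function.Periodic fω (2 * π, 0, 0)) (hωθ : Function.Periodic fω (0, 0, 2 * π))
    (hFφ : Function.Periodic fF (2 * π, 0, 0)) (hFθ : Function.Periodic fF (0, 0, 2 * π))
    (hGφ : Function.Periodic fG (2 * π, 0, 0)) (hGθ : Function.Periodic fG (0, 0, 2 * π))
    {w : ℝ} (hw : w ≠ 0) (hω0 : ∀ φ θ, fω (φ, A₀, θ) = 0)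
    (hω' : ∀ φ θ, HasFDerivAt fω (w • (ContinuousLinearMap.fst ℝ ℝ ℝ).comp
      (ContinuousLinearMap.snd ℝ ℝ (ℝ × ℝ))) (φ, A₀, θ))
    {κ₁ κ₂ : ℝ → ℝ} (hκ₁ : Continuous κ₁) (hκ₂ : Continuous κ₂) (T : ℝ) (v : ℝ × ℝ)
    {r₀ : ℝ} (hr₀ : 0 < r₀) :
    ∃ δ > 0, ∃ u : ℝ → (ℝ × ℝ →ᵇ ℝ × ℝ × ℝ), u 0 = 0 ∧ ∀ ε : ℝ, |ε| < δ → ‖u ε‖ < r₀ ∧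
      (∀ k : ℝ × ℝ, AnalyticAt ℝ (fun x : ℝ × ℝ × ℝ => u x.1 x.2) (ε, k)) ∧
      (∀ k, u ε (k + (2 * π, 0)) = u ε k) ∧ (∀ k, u ε (k + (0, 2 * π)) = u ε k) ∧
      ∃ h g : ℝ × ℝ →ᵇ ℝ,
        (∀ k, h k = fω ((k.1, A₀, k.2) + u ε k) + ε * fF ((k.1, A₀, k.2) + u ε k)) ∧
        (∀ k, g k = fG ((k.1, A₀, k.2) + u ε k)) ∧
        ∀ k, u ε k = (∫ s in (0 : ℝ)..T, κ₁ s * h (k + s • v),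
          (∫ s in (0 : ℝ)..T, κ₂ s * (u ε (k + s • v)).2.1)
            + ε * (∫ s in (0 : ℝ)..T, κ₁ s * g (k + s • v))
            - w⁻¹ * ∫ s in (0 : ℝ)..T, κ₂ s * h (k + s • v), 0) := by
  obtain ⟨Nω, hNω, rω, hrω, hNωf⟩ := exists_analyticAt_superposition_of_periodic hω hωφ hωθ
  obtain ⟨NF, hNF, rF, hrF, hNFf⟩ := exists_analyticAt_superposition_of_periodic hF hFφ hFθ
  obtain ⟨NG, hNG, rG, hrG, hNGf⟩ := exists_analyticAt_superposition_of_periodic hG hGφ hGθ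
  have hNω0 : Nω 0 = 0 := by
    ext k
    rw [hNωf 0 (by simpa using hrω)]
    simp [hω0]
  have hNω' : HasFDerivAt Nω (w • actionProj (ℝ × ℝ)) 0 :=
    hasFDerivAt_superposition (x := fun k : ℝ × ℝ => (k.1, A₀, k.2)) hNω hrω hNωf
      fun k => hω' k.1 k.2
  obtain ⟨ψ, hψ, hψ0, hiff⟩ := exists_analyticAt_auxResidual_eq_zero_iff
    (P := flowIntegral κ₁ hκ₁ T v) (M := flowIntegral κ₂ hκ₂ T v) hNω hNF hNG hNω0 hNω' hw
  obtain ⟨δ₁, hδ₁, hiff⟩ := Metric.eventually_nhds_iff.1 hiff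
  set ρ : ℝ := min (min δ₁ r₀) (min rω (min rF rG)) / 2 with hρ
  have hρ0 : 0 < ρ := by positivity
  have hρδ : 2 * ρ ≤ δ₁ := by
    rw [hρ, mul_div_cancel₀ _ two_ne_zero]; exact (min_le_left _ _).trans (min_le_left _ _)
  have hρr : 2 * ρ ≤ r₀ := by
    rw [hρ, mul_div_cancel₀ _ two_ne_zero]; exact (min_le_left _ _).trans (min_le_right _ _)
  have hρω : 2 * ρ ≤ rω := by
    rw [hρ, mul_div_cancel₀ _ two_ne_zero]; exact (min_le_right _ _).trans (min_le_left _ _)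
  have hρF : 2 * ρ ≤ rF := by
    rw [hρ, mul_div_cancel₀ _ two_ne_zero]
    exact (min_le_right _ _).trans ((min_le_right _ _).trans (min_le_left _ _))
  have hρG : 2 * ρ ≤ rG := by
    rw [hρ, mul_div_cancel₀ _ two_ne_zero]
    exact (min_le_right _ _).trans ((min_le_right _ _).trans (min_le_right _ _))
  have hiff' : ∀ p y, ‖p‖ < 2 * ρ → ‖y‖ < 2 * ρ →
      (auxResidual (flowIntegral κ₁ hκ₁ T v) (flowIntegral κ₂ hκ₂ T v) w Nω NF NG (p, y) = 0 ↔
        ψ p = y) := fun p y hp hy => by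
    refine hiff (y := (p, y)) ?_
    rw [dist_zero_right]
    exact max_lt (hp.trans_le hρδ) (hy.trans_le hρδ)
  have hsmall : ∀ᶠ p in 𝓝 0, AnalyticAt ℝ ψ p ∧ ‖ψ p‖ < ρ := by
    refine hψ.eventually_analyticAt.and ?_
    have : Tendsto (fun p => ‖ψ p‖) (𝓝 0) (𝓝 0) := by
      simpa [hψ0] using hψ.continuousAt.norm.tendsto
    exact this.eventually_lt_const hρ0
  obtain ⟨δ₂, hδ₂, hsmall⟩ := Metric.eventually_nhds_iff.1 hsmall
  set δ : ℝ := min δ₂ ρ with hδ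
  have hδ0 : 0 < δ := by positivity
  have hδρ : δ ≤ ρ := min_le_right _ _
  have hψs : ∀ p, ‖p‖ < δ → AnalyticAt ℝ ψ p ∧ ‖ψ p‖ < ρ := fun p hp =>
    hsmall (by rw [dist_zero_right]; exact hp.trans_le (min_le_left _ _))
  have hp0 : ∀ {ε : ℝ}, |ε| < δ → ‖((ε, 0) : ℝ × ℝ × ℝ × ℝ)‖ < δ := fun {ε} hε => by
    simpa [Prod.norm_def] using hε
  have hzero : ∀ {ε : ℝ}, |ε| < δ → auxResidual (flowIntegral κ₁ hκ₁ T v)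
      (flowIntegral κ₂ hκ₂ T v) w Nω NF NG ((ε, 0), ψ (ε, 0)) = 0 := fun {ε} hε =>
    (hiff' _ _ (by linarith [hp0 hε]) (by linarith [(hψs _ (hp0 hε)).2])).2 rfl
  -- uniqueness, applied to a shifted solution
  have hshift : ∀ {ε : ℝ} (c : ℝ × ℝ × ℝ) (s : ℝ × ℝ), |ε| < δ → ‖c‖ < δ → c.2.1 = 0 →
      (∀ f : ℝ × ℝ × ℝ → ℝ, Function.Periodic f (2 * π, 0, 0) →
        Function.Periodic f (0, 0, 2 * π) → ∀ (k : ℝ × ℝ) (z : ℝ × ℝ × ℝ),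
          f ((k.1, A₀, k.2) + (c + z)) = f (((k + s).1, A₀, (k + s).2) + z)) →
      ∀ k, ψ (ε, c) k = c + ψ (ε, 0) (k + s) := fun {ε} c s hε hcn hc hf => by
    set y := ψ (ε, 0) with hy
    let y' : ℝ × ℝ →ᵇ ℝ × ℝ × ℝ := constBoundedCLM _ _ c +
      y.compContinuous ⟨fun k => k + s, by fun_prop⟩
    have hyρ : ‖y‖ < ρ := (hψs _ (hp0 hε)).2
    have hy'k : ∀ k, y' k = c + y (k + s) := fun k => rfl
    have hy'ρ : ‖y'‖ < 2 * ρ := by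
      refine lt_of_le_of_lt ((BoundedContinuousFunction.norm_le (by positivity)).2
        fun k => (norm_add_le c _).trans (add_le_add_right (y.norm_coe_le_norm (k + s)) _)) ?_
      linarith
    have hN : ∀ {f : ℝ × ℝ × ℝ → ℝ} {N : (ℝ × ℝ →ᵇ ℝ × ℝ × ℝ) → (ℝ × ℝ →ᵇ ℝ)} {r : ℝ},
        Function.Periodic f (2 * π, 0, 0) → Function.Periodic f (0, 0, 2 * π) → 2 * ρ ≤ r →
        (∀ y, ‖y‖ < r → ∀ k : ℝ × ℝ, N y k = f ((k.1, A₀, k.2) + y k)) →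
        ∀ k, N y' k = N y (k + s) := fun {f N r} h1 h2 hr hNf k => by
      rw [hNf y' (by linarith), hNf y (by linarith), hy'k, hf f h1 h2]
    have hres := auxResidual_eq_zero_of_shift hc hy'k (hN hωφ hωθ hρω hNωf)
      (hN hFφ hFθ hρF hNFf) (hN hGφ hGθ hρG hNGf) (hzero hε)
    have hpc : ‖((ε, c) : ℝ × ℝ × ℝ × ℝ)‖ < 2 * ρ := by
      have : ‖((ε, c) : ℝ × ℝ × ℝ × ℝ)‖ < δ := max_lt hε hcn
      linarith
    intro k
    rw [(hiff' _ _ hpc hy'ρ).1 hres, hy'k]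
  refine ⟨δ, hδ0, fun ε => ψ (ε, 0), hψ0, fun ε hε => ?_⟩
  have hup : ‖ψ (ε, 0)‖ < ρ := (hψs _ (hp0 hε)).2
  refine ⟨by linarith, fun k₁ => ?_, fun k => ?_, fun k => ?_, ?_⟩
  · let c : ℝ × ℝ × ℝ → ℝ × ℝ × ℝ := fun x => (x.2.1 - k₁.1, 0, x.2.2 - k₁.2)
    have hc : AnalyticAt ℝ c (ε, k₁) :=
      ((analyticAt_fst.comp analyticAt_snd).sub analyticAt_const).prod
        (analyticAt_const.prod ((analyticAt_snd.comp analyticAt_snd).sub analyticAt_const))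
    have hc0 : c (ε, k₁) = 0 := by simp [c]
    have hψc : AnalyticAt ℝ (fun x : ℝ × ℝ × ℝ => ψ (x.1, c x)) (ε, k₁) :=
      (hψs _ (hp0 hε)).1.comp_of_eq (analyticAt_fst.prod hc) (by simp [hc0])
    have heval : AnalyticAt ℝ (fun x : ℝ × ℝ × ℝ => ψ (x.1, c x) k₁) (ε, k₁) :=
      ((BoundedContinuousFunction.evalCLM ℝ k₁ :
        (ℝ × ℝ →ᵇ ℝ × ℝ × ℝ) →L[ℝ] ℝ × ℝ × ℝ).analyticAt _).comp hψc
    refine (heval.sub hc).congr ?_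
    have h1 : ∀ᶠ x : ℝ × ℝ × ℝ in 𝓝 (ε, k₁), |x.1| < δ :=
      (continuous_fst.abs.tendsto (ε, k₁)).eventually_lt_const hε
    have h2 : ∀ᶠ x : ℝ × ℝ × ℝ in 𝓝 (ε, k₁), ‖c x‖ < δ :=
      hc.continuousAt.norm.tendsto.eventually_lt_const (by simpa [hc0] using hδ0)
    filter_upwards [h1, h2] with x hx1 hx2
    have := hshift (c x) (x.2 - k₁) hx1 hx2 rfl (fun f _ _ k z => by
      congr 1
      ext <;> simp [c] <;> ring) k₁
    rw [Pi.sub_apply, this, add_sub_cancel, add_sub_cancel_left]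
  · have := hshift 0 (2 * π, 0) hε (by simpa using hδ0) rfl (fun f h1 _ k z => by
      rw [← h1]
      congr 1
      ext <;> simp
      ring) k
    rw [this, zero_add]
  · have := hshift 0 (0, 2 * π) hε (by simpa using hδ0) rfl (fun f _ h2 k z => by
      rw [← h2]
      congr 1
      ext <;> simp
      ring) k
    rw [this, zero_add]
  · refine ⟨Nω (ψ (ε, 0)) + ε • NF (ψ (ε, 0)), NG (ψ (ε, 0)), fun k => ?_, fun k => ?_,
      fun k => ?_⟩
    · simp [hNωf _ (by linarith : ‖ψ (ε, 0)‖ < rω), hNFf _ (by linarith : ‖ψ (ε, 0)‖ < rF)]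
    · exact hNGf _ (by linarith) k
    · rw [auxResidual_eq_zero_iff.1 (hzero hε) k, zero_add]
      rfl

end SolutionField

section AuxiliaryFamily

/-- A pair of periodic functions solving the integral form of the auxiliary system solves the
differential form: the mean of `h` vanishes, and so does the mean of `β`. -/
theorem hasDerivAt_of_sawtooth_integral_eq {T ε w : ℝ} (hT : T ≠ 0) (hw : w ≠ 0)
    {h g β B : ℝ → ℝ} (hh : Continuous h) (hg : Continuous g)
    (hhT : Function.Periodic h T) (hgT : Function.Periodic g T) (hBT : Function.Periodic B T)
    (hβ : ∀ t, β t = ∫ s in (0 : ℝ)..T, (s / T - 1 / 2) * h (t + s))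
    (hBeq : ∀ t, B t = (∫ s in (0 : ℝ)..T, 1 / T * B (t + s))
      + ε * (∫ s in (0 : ℝ)..T, (s / T - 1 / 2) * g (t + s))
      - w⁻¹ * ∫ s in (0 : ℝ)..T, 1 / T * h (t + s)) :
    ∫ t in (0 : ℝ)..T, β t = 0 ∧ (∀ t, HasDerivAt β (h t) t) ∧
      ∀ t, HasDerivAt B (ε * (g t - 1 / T * ∫ s in (0 : ℝ)..T, g s)) t := by
  have hβ' : β = fun t => ∫ s in (0 : ℝ)..T, (s / T - 1 / 2) * h (t + s) := funext hβ
  set I : ℝ → ℝ := fun t => ∫ s in (0 : ℝ)..T, (s / T - 1 / 2) * g (t + s) with hI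
  set b : ℝ := ∫ s in (0 : ℝ)..T, B s
  set m : ℝ := ∫ s in (0 : ℝ)..T, h s with hm
  have hI' : ∀ t, HasDerivAt I (g t - 1 / T * ∫ s in (0 : ℝ)..T, g s) t :=
    hasDerivAt_sawtooth_integral hT hg hgT
  have hIc : Continuous I := continuous_iff_continuousAt.2 fun t => (hI' t).continuousAt
  have hB' : B = fun t => 1 / T * b + ε * I t - w⁻¹ * (1 / T * m) := by
    funext t
    rw [hBeq t, intervalIntegral.integral_const_mul, intervalIntegral.integral_const_mul,
      integral_comp_add_left_of_periodic hBT, integral_comp_add_left_of_periodic hhT]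
  have hm0 : m = 0 := by
    have h1 : b = ∫ t in (0 : ℝ)..T, (1 / T * b - w⁻¹ * (1 / T * m) + ε * I t) := by
      conv_lhs => rw [show b = ∫ t in (0 : ℝ)..T, B t from rfl]
      refine intervalIntegral.integral_congr fun t _ => ?_
      rw [congrFun hB' t]
      ring
    rw [intervalIntegral.integral_add (by simp) ((hIc.const_mul ε).intervalIntegrable _ _),
      intervalIntegral.integral_const_mul, integral_sawtooth_integral_eq_zero hg hgT,
      intervalIntegral.integral_const] at h1
    simp only [sub_zero, smul_eq_mul, mul_zero, add_zero] at h1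
    field_simp at h1
    linarith
  refine ⟨?_, fun t => ?_, fun t => ?_⟩
  · rw [hβ']
    exact integral_sawtooth_integral_eq_zero hh hhT
  · rw [hβ']
    simpa [← hm, hm0] using hasDerivAt_sawtooth_integral hT hh hhT t
  · rw [hB']
    exact (((hI' t).const_mul ε).const_add _).sub_const _

/-- A function on the plane that is `2π`-periodic in both variables is periodic along
rational lines. -/
theorem periodic_along_rational_line {α : Type*} {f : ℝ × ℝ → α}
    (h₁ : ∀ k, f (k + (2 * π, 0)) = f k) (h₂ : ∀ k, f (k + (0, 2 * π)) = f k)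
    {ω₀ T : ℝ} {p q : ℤ} (hT : T = 2 * π * q) (hω₀ : ω₀ * T = 2 * π * p) (φ θ : ℝ) :
    Function.Periodic (fun t : ℝ => f (ω₀ * t + φ, t + θ)) T := by
  intro t
  beta_reduce
  have h1 : Function.Periodic f (2 * π, 0) := h₁
  have h2 : Function.Periodic f (0, 2 * π) := h₂
  refine Eq.trans ?_ ((h2.zsmul q _).trans (h1.zsmul p (ω₀ * t + φ, t + θ)))
  congr 1
  ext
  · simp only [Prod.fst_add, Prod.smul_mk, zsmul_eq_mul, mul_zero]
    linear_combination hω₀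
  · simp only [Prod.snd_add, Prod.smul_mk, zsmul_eq_mul, mul_zero]
    linear_combination hT

end AuxiliaryFamily

end

/-- Lemma 1 of the paper.  Assume Hypothesis 1 (`ω'(A₀) ≠ 0`).  Then for
every `t₀ ∈ ℝ` an analytic auxiliary family exists: there are a neighbourhood `U` of
`(0,0)` in `ℝ²` and functions `β̃(t;ε,β₀)`, `B(t;ε,β₀)`, `T`-periodic and jointly
real-analytic in `(t,ε,β₀)` on `ℝ × U`, with `β̃` of zero mean in `t` over `[0,T]` and
`β̃ = B = 0` for `ε = 0`, such that `α(t) := α₀(t) + β₀ + β̃(t;ε,β₀)`,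
`A(t) := A₀ + B(t;ε,β₀)` satisfy, for all `(ε,β₀) ∈ U` and all `t ∈ ℝ`,
`α̇(t) = ω(A(t)) + ε F(α(t),A(t),t+t₀)` and
`Ȧ(t) = ε G(α(t),A(t),t+t₀) − (1/T) ∫₀ᵀ ε G(α(τ),A(τ),τ+t₀) dτ`. -/
theorem auxiliary_family_exists
    (W : Set ℝ) (hW : IsOpen W)
    (ω : ℝ → ℝ) (hω : AnalyticOnNhd ℝ ω W)
    (F G : ℝ → ℝ → ℝ → ℝ)
    (hF : AnalyticOnNhd ℝ (fun x : ℝ × ℝ × ℝ => F x.1 x.2.1 x.2.2)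
      {x : ℝ × ℝ × ℝ | x.2.1 ∈ W})
    (hG : AnalyticOnNhd ℝ (fun x : ℝ × ℝ × ℝ => G x.1 x.2.1 x.2.2)
      {x : ℝ × ℝ × ℝ | x.2.1 ∈ W})
    (hFα : ∀ α A t, F (α + 2 * π) A t = F α A t)
    (hFt : ∀ α A t, F α A (t + 2 * π) = F α A t)
    (hGα : ∀ α A t, G (α + 2 * π) A t = G α A t)
    (hGt : ∀ α A t, G α A (t + 2 * π) = G α A t)
    (A₀ : ℝ) (hA₀ : A₀ ∈ W)
    (p q : ℤ) (hq : 1 ≤ q) (hp : p ≠ 0) (hpq : Int.gcd p q = 1)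
    (hω₀ : ω A₀ = (p : ℝ) / (q : ℝ))
    (T : ℝ) (hT : T = 2 * π * (q : ℝ))
    -- Hypothesis 1:
    (hyp1 : deriv ω A₀ ≠ 0) :
    ∀ t₀ : ℝ, ∃ U : Set (ℝ × ℝ), ∃ βt Bf : ℝ → ℝ → ℝ → ℝ,
      IsOpen U ∧ (0, 0) ∈ U ∧
      -- joint real-analyticity in (t, ε, β₀) on ℝ × U
      AnalyticOnNhd ℝ (fun x : ℝ × ℝ × ℝ => βt x.1 x.2.1 x.2.2)
        {x : ℝ × ℝ × ℝ | (x.2.1, x.2.2) ∈ U} ∧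
      AnalyticOnNhd ℝ (fun x : ℝ × ℝ × ℝ => Bf x.1 x.2.1 x.2.2)
        {x : ℝ × ℝ × ℝ | (x.2.1, x.2.2) ∈ U} ∧
      -- T-periodicity in t
      (∀ ε β₀ : ℝ, (ε, β₀) ∈ U → ∀ t : ℝ,
        βt (t + T) ε β₀ = βt t ε β₀ ∧ Bf (t + T) ε β₀ = Bf t ε β₀) ∧
      -- β̃ has zero mean in t over [0, T]
      (∀ ε β₀ : ℝ, (ε, β₀) ∈ U → (∫ t in (0:ℝ)..T, βt t ε β₀) = 0) ∧
      -- β̃ = B = 0 for ε = 0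
      (∀ β₀ : ℝ, ((0:ℝ), β₀) ∈ U → ∀ t : ℝ, βt t 0 β₀ = 0 ∧ Bf t 0 β₀ = 0) ∧
      -- A(t) stays in W, and the modified equations of motion hold
      (∀ ε β₀ : ℝ, (ε, β₀) ∈ U → ∀ t : ℝ, A₀ + Bf t ε β₀ ∈ W) ∧
      (∀ ε β₀ : ℝ, (ε, β₀) ∈ U → ∀ t : ℝ,
        HasDerivAt (fun s => ω A₀ * s + β₀ + βt s ε β₀)
          (ω (A₀ + Bf t ε β₀) +
            ε * F (ω A₀ * t + β₀ + βt t ε β₀) (A₀ + Bf t ε β₀) (t + t₀)) t ∧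
        HasDerivAt (fun s => A₀ + Bf s ε β₀)
          (ε * G (ω A₀ * t + β₀ + βt t ε β₀) (A₀ + Bf t ε β₀) (t + t₀) -
            (1 / T) * ∫ τ in (0:ℝ)..T,
              ε * G (ω A₀ * τ + β₀ + βt τ ε β₀) (A₀ + Bf τ ε β₀) (τ + t₀)) t) := by
  intro t₀
  obtain ⟨r₀, hr₀, hball⟩ := Metric.isOpen_iff.1 hW A₀ hA₀
  have hq0 : (q : ℝ) ≠ 0 := by
    have : q ≠ 0 := by omega
    exact_mod_cast this
  have hT0 : T ≠ 0 := by
    rw [hT]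
    positivity
  have hωT : ω A₀ * T = 2 * π * p := by
    rw [hω₀, hT]
    field_simp
  have hωA : ∀ φ θ : ℝ,
      AnalyticAt ℝ (fun x : ℝ × ℝ × ℝ => ω x.2.1 - ω A₀) (φ, A₀, θ) := fun φ θ =>
    ((hω A₀ hA₀).comp_of_eq (f := fun x : ℝ × ℝ × ℝ => x.2.1)
      (analyticAt_fst.comp analyticAt_snd) rfl).sub analyticAt_const
  have hω' : ∀ φ θ : ℝ, HasFDerivAt (fun x : ℝ × ℝ × ℝ => ω x.2.1 - ω A₀)
      (deriv ω A₀ • (ContinuousLinearMap.fst ℝ ℝ ℝ).comp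
        (ContinuousLinearMap.snd ℝ ℝ (ℝ × ℝ))) (φ, A₀, θ) := fun φ θ =>
    (HasDerivAt.comp_hasFDerivAt_of_eq (φ, A₀, θ) (hω A₀ hA₀).differentiableAt.hasDerivAt
      ((ContinuousLinearMap.fst ℝ ℝ ℝ).comp
        (ContinuousLinearMap.snd ℝ ℝ (ℝ × ℝ))).hasFDerivAt rfl).sub_const _
  obtain ⟨δ, hδ, u, hu0, hu⟩ := exists_analytic_solution_field
    (fω := fun x => ω x.2.1 - ω A₀) (fF := fun x => F x.1 x.2.1 x.2.2)
    (fG := fun x => G x.1 x.2.1 x.2.2) (A₀ := A₀) hωA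
    (fun φ θ => hF _ hA₀) (fun φ θ => hG _ hA₀) (fun x => by simp) (fun x => by simp)
    (fun x => by simp [hFα]) (fun x => by simp [hFt]) (fun x => by simp [hGα])
    (fun x => by simp [hGt]) hyp1 (by simp) hω' (κ₁ := fun s => s / T - 1 / 2)
    (κ₂ := fun _ => 1 / T) (by fun_prop) (by fun_prop) T (ω A₀, 1) hr₀
  have hana : ∀ x : ℝ × ℝ × ℝ, |x.2.1| < δ → AnalyticAt ℝ
      (fun x : ℝ × ℝ × ℝ => u x.2.1 (ω A₀ * x.1 + x.2.2, x.1 + t₀)) x := fun x hx => by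
    have hin : AnalyticAt ℝ
        (fun x : ℝ × ℝ × ℝ => (x.2.1, (ω A₀ * x.1 + x.2.2, x.1 + t₀))) x :=
      (analyticAt_fst.comp analyticAt_snd).prod
        (((analyticAt_const.mul analyticAt_fst).add (analyticAt_snd.comp analyticAt_snd)).prod
          (analyticAt_fst.add analyticAt_const))
    exact ((hu x.2.1 hx).2.1 (ω A₀ * x.1 + x.2.2, x.1 + t₀)).comp_of_eq hin rfl
  have hmain : ∀ ε β₀ : ℝ, |ε| < δ →
      (∀ t, (u ε (ω A₀ * (t + T) + β₀, t + T + t₀)) = u ε (ω A₀ * t + β₀, t + t₀)) ∧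
      (∫ t in (0 : ℝ)..T, (u ε (ω A₀ * t + β₀, t + t₀)).1) = 0 ∧
      (∀ t, A₀ + (u ε (ω A₀ * t + β₀, t + t₀)).2.1 ∈ W) ∧
      (∀ t, HasDerivAt (fun t => (u ε (ω A₀ * t + β₀, t + t₀)).1)
        (ω (A₀ + (u ε (ω A₀ * t + β₀, t + t₀)).2.1) - ω A₀ + ε *
          F (ω A₀ * t + β₀ + (u ε (ω A₀ * t + β₀, t + t₀)).1)
            (A₀ + (u ε (ω A₀ * t + β₀, t + t₀)).2.1) (t + t₀)) t) ∧
      ∀ t, HasDerivAt (fun t => (u ε (ω A₀ * t + β₀, t + t₀)).2.1)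
        (ε * (G (ω A₀ * t + β₀ + (u ε (ω A₀ * t + β₀, t + t₀)).1)
            (A₀ + (u ε (ω A₀ * t + β₀, t + t₀)).2.1) (t + t₀) - 1 / T * ∫ τ in (0 : ℝ)..T,
          G (ω A₀ * τ + β₀ + (u ε (ω A₀ * τ + β₀, τ + t₀)).1)
            (A₀ + (u ε (ω A₀ * τ + β₀, τ + t₀)).2.1) (τ + t₀))) t := fun ε β₀ hε => by
    obtain ⟨hnorm, -, hper₁, hper₂, h, g, hh, hg, heq⟩ := hu ε hε
    have hu3 : ∀ k, (u ε k).2.2 = 0 := fun k => by rw [heq k]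
    have hh₁ : ∀ k, h (k + (2 * π, 0)) = h k := fun k => by
      simp [hh, hper₁, add_right_comm _ (2 * π), hFα]
    have hh₂ : ∀ k, h (k + (0, 2 * π)) = h k := fun k => by
      simp [hh, hper₂, add_right_comm _ (2 * π), hFt]
    have hg₁ : ∀ k, g (k + (2 * π, 0)) = g k := fun k => by
      simp [hg, hper₁, add_right_comm _ (2 * π), hGα]
    have hg₂ : ∀ k, g (k + (0, 2 * π)) = g k := fun k => by
      simp [hg, hper₂, add_right_comm _ (2 * π), hGt]
    have huT := periodic_along_rational_line hper₁ hper₂ hT hωT β₀ t₀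
    have hline : ∀ t s : ℝ, (ω A₀ * t + β₀, t + t₀) + s • (ω A₀, (1 : ℝ))
        = (ω A₀ * (t + s) + β₀, t + s + t₀) := fun t s => by
      ext <;> simp <;> ring
    obtain ⟨hmean, hβ', hB'⟩ := hasDerivAt_of_sawtooth_integral_eq hT0 hyp1 (ε := ε)
      (h := fun t => h (ω A₀ * t + β₀, t + t₀)) (g := fun t => g (ω A₀ * t + β₀, t + t₀))
      (β := fun t => (u ε (ω A₀ * t + β₀, t + t₀)).1)
      (B := fun t => (u ε (ω A₀ * t + β₀, t + t₀)).2.1)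
      (by fun_prop) (by fun_prop)
      (periodic_along_rational_line hh₁ hh₂ hT hωT β₀ t₀)
      (periodic_along_rational_line hg₁ hg₂ hT hωT β₀ t₀)
      (huT.comp fun y => y.2.1)
      (fun t => by simp only [← hline]; exact congrArg Prod.fst (heq _))
      (fun t => by simp only [← hline]; exact congrArg (fun y => y.2.1) (heq _))
    refine ⟨huT, hmean, fun t => hball ?_, fun t => ?_, fun t => ?_⟩
    · have h1 : ‖(u ε (ω A₀ * t + β₀, t + t₀)).2.1‖ ≤ ‖u ε‖ :=
        ((norm_fst_le _).trans (norm_snd_le _)).trans ((u ε).norm_coe_le_norm _)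
      simpa using h1.trans_lt hnorm
    · simpa [hh, hu3] using hβ' t
    · simpa [hg, hu3] using hB' t
  refine ⟨{x | |x.1| < δ}, fun t ε β₀ => (u ε (ω A₀ * t + β₀, t + t₀)).1,
    fun t ε β₀ => (u ε (ω A₀ * t + β₀, t + t₀)).2.1,
    isOpen_lt (by fun_prop) continuous_const, by simpa using hδ,
    fun x hx => analyticAt_fst.comp (hana x hx),
    fun x hx => (analyticAt_fst.comp analyticAt_snd).comp (hana x hx),
    fun ε β₀ hε t => ?_, fun ε β₀ hε => (hmain ε β₀ hε).2.1, fun β₀ _ t => by simp [hu0],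
    fun ε β₀ hε => (hmain ε β₀ hε).2.2.1, fun ε β₀ hε t => ⟨?_, ?_⟩⟩
  · simp [(hmain ε β₀ hε).1 t]
  · have h1 : HasDerivAt (fun s => ω A₀ * s + β₀) (ω A₀) t := by
      simpa using ((hasDerivAt_id t).const_mul (ω A₀)).add_const β₀
    exact (h1.add ((hmain ε β₀ hε).2.2.2.1 t)).congr_deriv (by ring)
  · refine (((hmain ε β₀ hε).2.2.2.2 t).const_add A₀).congr_deriv ?_
    rw [intervalIntegral.integral_const_mul]
    ring
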